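/- arXiv:2512.05826 — 3 statements merged into one kernel-verified Lean document; each statement's English description precedes it below -/
import Mathlib

section
/- Let X be a locally compact Polish space and let (μ_n) and μ be Borel probability measures on X such that μ_n converges narrowly to μ, i.e. ∫_X ξ dμ_n → ∫_X ξ dμ for every bounded continuous ξ : X → ℝ. Let u_n, v_n : X → ℝ be Borel functions with ∫_X u_n² dμ_n < ∞ and ∫_X v_n² dμ_n < ∞, and let u, v : X → ℝ be Borel with ∫_X u² dμ < ∞ and ∫_X v² dμ < ∞. Assume: (i) ∫_X u_n ξ dμ_n → ∫_X u ξ dμ and ∫_X v_n ξ dμ_n → ∫_X v ξ dμ for every continuous compactly supported ξ : X → ℝ; (ii) sup_n ∫_X v_n² dμ_n < ∞; (iii) ∫_X u_n² dμ_n → ∫_X u² dμ. Then ∫_X u_n v_n dμ_n → ∫_X u v dμ. -/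
open MeasureTheory Filter Topology

/-- Cauchy–Schwarz in weighted additive form. -/
theorem abs_integral_mul_le_weighted {X : Type*} [MeasurableSpace X] {μ : Measure X}
    {f g : X → ℝ} (hf : MemLp f 2 μ) (hg : MemLp g 2 μ) {t : ℝ} (ht : 0 < t) :
    |∫ x, f x * g x ∂μ| ≤ t⁻¹ * ∫ x, f x ^ 2 ∂μ + t * ∫ x, g x ^ 2 ∂μ := by
  have hf2 := hf.integrable_sq.const_mul t⁻¹
  have hg2 := hg.integrable_sq.const_mul t
  rw [← integral_const_mul, ← integral_const_mul, ← integral_add hf2 hg2]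
  refine abs_integral_le_integral_abs.trans
    (integral_mono (hf.integrable_mul hg).abs (hf2.add hg2) fun x => ?_)
  have hsq : t⁻¹ * f x ^ 2 + t * g x ^ 2 - 2 * (|f x| * |g x|) =
      t⁻¹ * (|f x| - t * |g x|) ^ 2 := by
    rw [← sq_abs (f x), ← sq_abs (g x)]
    field_simp
    ring
  have hnonneg : 0 ≤ t⁻¹ * (|f x| - t * |g x|) ^ 2 := by positivity
  have hmul : 0 ≤ |f x| * |g x| := by positivity
  change |f x * g x| ≤ t⁻¹ * f x ^ 2 + t * g x ^ 2
  rw [abs_mul]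
  linarith

theorem integral_sub_sq {X : Type*} [MeasurableSpace X] {μ : Measure X}
    {f g : X → ℝ} (hf : MemLp f 2 μ) (hg : MemLp g 2 μ) :
    ∫ x, (f x - g x) ^ 2 ∂μ =
      ∫ x, f x ^ 2 ∂μ - 2 * ∫ x, f x * g x ∂μ + ∫ x, g x ^ 2 ∂μ := by
  have hfg : Integrable (fun x => f x * g x) μ := hf.integrable_mul hg
  have hsub : Integrable (fun x => f x ^ 2 - 2 * (f x * g x)) μ :=
    hf.integrable_sq.sub (hfg.const_mul 2)
  rw [← integral_const_mul, ← integral_sub hf.integrable_sq (hfg.const_mul 2),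
    ← integral_add hsub hg.integrable_sq]
  exact integral_congr_ae (.of_forall fun x => by ring)

/-- Continuous compactly supported functions are dense in `L²` of a finite measure on a locally
compact Polish space. -/
theorem exists_continuous_hasCompactSupport_integral_sub_sq_le
    {X : Type*} [TopologicalSpace X] [PolishSpace X] [LocallyCompactSpace X]
    [MeasurableSpace X] [BorelSpace X] {μ : Measure X} [IsFiniteMeasure μ]
    {f : X → ℝ} (hf : MemLp f 2 μ) {ε : ℝ} (hε : 0 < ε) :
    ∃ g : X → ℝ, Continuous g ∧ HasCompactSupport g ∧ ∫ x, (f x - g x) ^ 2 ∂μ ≤ ε := by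
  let _ := TopologicalSpace.upgradeIsCompletelyMetrizable X
  have hf' : MemLp f (ENNReal.ofReal 2) μ := by simpa using hf
  obtain ⟨g, hg_supp, hg, hg_cont, -⟩ :=
    hf'.exists_hasCompactSupport_integral_rpow_sub_le two_pos hε
  exact ⟨g, hg_cont, hg_supp, by simpa using hg⟩

/-- Weak–strong convergence with varying base measures: if `μ n ⇀ ν` narrowly,
`u n ⇀ u₀` and `v n ⇀ v₀` weakly against continuous compactly supported test
functions, `v n` is uniformly bounded in `L²(μ n)`, and `u n` converges in norm,
then `∫ uₙ vₙ dμₙ → ∫ u₀ v₀ dν`. -/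
theorem weak_strong_convergence
    {X : Type*} [TopologicalSpace X] [PolishSpace X] [LocallyCompactSpace X]
    [MeasurableSpace X] [BorelSpace X]
    (μ : ℕ → Measure X) (ν : Measure X)
    (hμ : ∀ n, IsProbabilityMeasure (μ n)) (hν : IsProbabilityMeasure ν)
    (hnarrow : ∀ ξ : X → ℝ, Continuous ξ → (∃ C : ℝ, ∀ x, |ξ x| ≤ C) →
      Tendsto (fun n => ∫ x, ξ x ∂(μ n)) atTop (𝓝 (∫ x, ξ x ∂ν)))
    (u v : ℕ → X → ℝ) (u₀ v₀ : X → ℝ)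
    (hu_meas : ∀ n, Measurable (u n)) (hv_meas : ∀ n, Measurable (v n))
    (hu₀_meas : Measurable u₀) (hv₀_meas : Measurable v₀)
    (hu_sq : ∀ n, Integrable (fun x => (u n x) ^ 2) (μ n))
    (hv_sq : ∀ n, Integrable (fun x => (v n x) ^ 2) (μ n))
    (hu₀_sq : Integrable (fun x => (u₀ x) ^ 2) ν)
    (hv₀_sq : Integrable (fun x => (v₀ x) ^ 2) ν)
    (hu_weak : ∀ ξ : X → ℝ, Continuous ξ → HasCompactSupport ξ →
      Tendsto (fun n => ∫ x, u n x * ξ x ∂(μ n)) atTop (𝓝 (∫ x, u₀ x * ξ x ∂ν)))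
    (hv_weak : ∀ ξ : X → ℝ, Continuous ξ → HasCompactSupport ξ →
      Tendsto (fun n => ∫ x, v n x * ξ x ∂(μ n)) atTop (𝓝 (∫ x, v₀ x * ξ x ∂ν)))
    (hv_bdd : ∃ C : ℝ, ∀ n, ∫ x, (v n x) ^ 2 ∂(μ n) ≤ C)
    (hu_norm : Tendsto (fun n => ∫ x, (u n x) ^ 2 ∂(μ n)) atTop
      (𝓝 (∫ x, (u₀ x) ^ 2 ∂ν))) :
    Tendsto (fun n => ∫ x, u n x * v n x ∂(μ n)) atTop
      (𝓝 (∫ x, u₀ x * v₀ x ∂ν)) := by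
  obtain ⟨C, hC⟩ := hv_bdd
  have hu : ∀ n, MemLp (u n) 2 (μ n) := fun n =>
    (memLp_two_iff_integrable_sq (hu_meas n).aestronglyMeasurable).2 (hu_sq n)
  have hv : ∀ n, MemLp (v n) 2 (μ n) := fun n =>
    (memLp_two_iff_integrable_sq (hv_meas n).aestronglyMeasurable).2 (hv_sq n)
  have hu₀ : MemLp u₀ 2 ν :=
    (memLp_two_iff_integrable_sq hu₀_meas.aestronglyMeasurable).2 hu₀_sq
  have hv₀ : MemLp v₀ 2 ν :=
    (memLp_two_iff_integrable_sq hv₀_meas.aestronglyMeasurable).2 hv₀_sq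
  obtain ⟨M, hM, hCM, hv₀M⟩ : ∃ M : ℝ, 0 < M ∧ C ≤ M ∧ ∫ x, v₀ x ^ 2 ∂ν ≤ M :=
    ⟨max 1 (max C (∫ x, v₀ x ^ 2 ∂ν)), by positivity, by simp, by simp⟩
  refine Metric.tendsto_nhds.2 fun ε' hε' => ?_
  obtain ⟨ε, hε, rfl⟩ : ∃ ε : ℝ, 0 < ε ∧ 6 * ε = ε' := ⟨ε' / 6, by positivity, by ring⟩
  obtain ⟨t, ht, htM⟩ : ∃ t : ℝ, 0 < t ∧ t * M = ε := ⟨ε / M, by positivity, by field_simp⟩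
  obtain ⟨ξ, hξ_cont, hξ_supp, hξ⟩ :=
    exists_continuous_hasCompactSupport_integral_sub_sq_le hu₀ (mul_pos ht hε)
  obtain ⟨B, hB⟩ := hξ_supp.exists_bound_of_continuous hξ_cont
  have hξ_mem (m : Measure X) [IsProbabilityMeasure m] : MemLp ξ 2 m :=
    MemLp.of_bound hξ_cont.aestronglyMeasurable B (.of_forall hB)
  have hξ_sq : Tendsto (fun n => ∫ x, ξ x ^ 2 ∂μ n) atTop (𝓝 (∫ x, ξ x ^ 2 ∂ν)) :=
    hnarrow (fun x => ξ x ^ 2) (hξ_cont.pow 2) ⟨B ^ 2, fun x => by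
      rw [abs_pow]
      exact pow_le_pow_left₀ (abs_nonneg _) (hB x) 2⟩
  have hsub : Tendsto (fun n => ∫ x, (u n x - ξ x) ^ 2 ∂μ n) atTop
      (𝓝 (∫ x, (u₀ x - ξ x) ^ 2 ∂ν)) := by
    simp_rw [integral_sub_sq hu₀ (hξ_mem ν), fun n => integral_sub_sq (hu n) (hξ_mem (μ n))]
    exact (hu_norm.sub ((hu_weak ξ hξ_cont hξ_supp).const_mul 2)).add hξ_sq
  have hsplit (m : Measure X) [IsProbabilityMeasure m] {f g : X → ℝ} (hf : MemLp f 2 m)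
      (hg : MemLp g 2 m) :
      ∫ x, f x * g x ∂m = ∫ x, (f x - ξ x) * g x ∂m + ∫ x, g x * ξ x ∂m := by
    have hfξ : Integrable (fun x => (f x - ξ x) * g x) m :=
      (hf.sub (hξ_mem m)).integrable_mul hg
    have hgξ : Integrable (fun x => g x * ξ x) m := hg.integrable_mul (hξ_mem m)
    rw [← integral_add hfξ hgξ]
    exact integral_congr_ae (.of_forall fun x => by ring)
  have hbound (m : Measure X) [IsProbabilityMeasure m] {f g : X → ℝ} (hf : MemLp f 2 m)
      (hg : MemLp g 2 m) (hgM : ∫ x, g x ^ 2 ∂m ≤ M) {b : ℝ}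
      (hfb : ∫ x, (f x - ξ x) ^ 2 ∂m ≤ t * b) :
      |∫ x, (f x - ξ x) * g x ∂m| ≤ b + ε := by
    refine (abs_integral_mul_le_weighted (hf.sub (hξ_mem m)) hg ht).trans (add_le_add ?_ ?_)
    · rwa [inv_mul_le_iff₀ ht]
    · exact htM ▸ mul_le_mul_of_nonneg_left hgM ht.le
  have hlt : t * ε < t * (2 * ε) := by nlinarith [mul_pos ht hε]
  filter_upwards [hsub.eventually_lt_const (hξ.trans_lt hlt),
    Metric.tendsto_nhds.1 (hv_weak ξ hξ_cont hξ_supp) ε hε] with n hn hvn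
  rw [Real.dist_eq, abs_lt] at hvn ⊢
  have hn' := abs_le.1 (hbound (μ n) (hu n) (hv n) ((hC n).trans hCM) hn.le)
  have hν' := abs_le.1 (hbound ν hu₀ hv₀ hv₀M hξ)
  rw [hsplit (μ n) (hu n) (hv n), hsplit ν hu₀ hv₀]
  constructor <;> linarith
end

section
/- Let (Y, 𝒜, κ) be a measure space, E a real Hilbert space, f : Y → E strongly measurable, and g : Y → ℝ measurable with g > 0 κ-almost everywhere. Assume g is integrable and ∫_Y ‖f‖²/g dκ < ∞. Then f is Bochner integrable and ‖∫_Y f dκ‖² ≤ (∫_Y g dκ) · (∫_Y ‖f‖²/g dκ). -/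
open MeasureTheory

/-- Weighted vector-valued Cauchy–Schwarz (Jensen's inequality for the jointly
convex 1-homogeneous function `A(a,b) = ‖b‖²/a`): if `g > 0` a.e. is integrable
and `∫ ‖f‖²/g dκ < ∞`, then `f` is Bochner integrable and
`‖∫ f dκ‖² ≤ (∫ g dκ) · (∫ ‖f‖²/g dκ)`. -/
theorem weighted_cauchy_schwarz
    {Y : Type*} [MeasurableSpace Y] (κ : Measure Y)
    {E : Type*} [NormedAddCommGroup E] [InnerProductSpace ℝ E] [CompleteSpace E]
    (f : Y → E) (hf : StronglyMeasurable f)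
    (g : Y → ℝ) (hg_meas : Measurable g) (hg_pos : ∀ᵐ y ∂κ, 0 < g y)
    (hg_int : Integrable g κ)
    (hfg : Integrable (fun y => ‖f y‖ ^ 2 / g y) κ) :
    Integrable f κ ∧
      ‖∫ y, f y ∂κ‖ ^ 2 ≤ (∫ y, g y ∂κ) * ∫ y, ‖f y‖ ^ 2 / g y ∂κ := by
  have young : ∀ x : ℝ, ∀ᵐ y ∂κ, 2 * x * ‖f y‖ ≤ g y * (x * x) + ‖f y‖ ^ 2 / g y := by
    intro x
    filter_upwards [hg_pos] with y hy
    have hsq : g y * (x * x) + ‖f y‖ ^ 2 / g y - 2 * x * ‖f y‖ =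
        (g y * x - ‖f y‖) ^ 2 / g y := by
      field_simp
      ring
    have : 0 ≤ (g y * x - ‖f y‖) ^ 2 / g y := by positivity
    linarith
  have hf_int : Integrable f κ := by
    refine (hg_int.add hfg).mono' hf.aestronglyMeasurable ?_
    filter_upwards [young 1] with y hy
    have := norm_nonneg (f y)
    simp only [Pi.add_apply]
    linarith
  refine ⟨hf_int, ?_⟩
  have hdiscrim : discrim (∫ y, g y ∂κ) (-2 * ∫ y, ‖f y‖ ∂κ) (∫ y, ‖f y‖ ^ 2 / g y ∂κ) ≤ 0 := by
    refine discrim_le_zero fun x => ?_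
    have h := integral_mono_ae (hf_int.norm.const_mul (2 * x))
      ((hg_int.mul_const (x * x)).add hfg) (young x)
    simp only [Pi.add_apply] at h
    rw [integral_const_mul, integral_add (hg_int.mul_const _) hfg, integral_mul_const] at h
    linarith
  calc ‖∫ y, f y ∂κ‖ ^ 2 ≤ (∫ y, ‖f y‖ ∂κ) ^ 2 := by
        gcongr
        exact norm_integral_le_integral_norm f
    _ ≤ (∫ y, g y ∂κ) * ∫ y, ‖f y‖ ^ 2 / g y ∂κ := by
        rw [discrim] at hdiscrim
        linarith
end

section
/- Let E be a real Hilbert space, η : ℝ → [0, ∞) integrable with ∫_ℝ η(t) dt = 1, ρ : ℝ → (0, ∞) integrable, and F : ℝ → E strongly measurable with ∫_ℝ ‖F(t)‖²/ρ(t) dt < ∞. Then F is Bochner integrable, the convolutions (η∗F)(t) = ∫_ℝ η(t−s)F(s) ds and (η∗ρ)(t) = ∫_ℝ η(t−s)ρ(s) ds are well defined for almost every t, at almost every t where (η∗ρ)(t) = 0 one also has (η∗F)(t) = 0, and ∫_ℝ ‖(η∗F)(t)‖²/(η∗ρ)(t) dt ≤ ∫_ℝ ‖F(t)‖²/ρ(t)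 dt, where the integrand on the left is interpreted as 0 at points where (η∗ρ)(t) = 0. -/
open MeasureTheory Filter

/-- Cauchy–Schwarz inequality for the kinetic action with a nonnegative weight `w`. -/
theorem norm_integral_smul_sq_le_integral_mul_integral
    {α E : Type*} [MeasurableSpace α] {μ : Measure α}
    [NormedAddCommGroup E] [NormedSpace ℝ E]
    {w ρ : α → ℝ} {F : α → E} (hw : ∀ s, 0 ≤ w s) (hρ : ∀ s, 0 < ρ s)
    (hwF : Integrable (fun s => w s • F s) μ) (hwρ : Integrable (fun s => w s * ρ s) μ)
    (hwA : Integrable (fun s => w s * (‖F s‖ ^ 2 / ρ s)) μ) :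
    ‖∫ s, w s • F s ∂μ‖ ^ 2 ≤
      (∫ s, w s * ρ s ∂μ) * ∫ s, w s * (‖F s‖ ^ 2 / ρ s) ∂μ := by
  have quadratic_nonneg (c : ℝ) : 0 ≤ (∫ s, w s * ρ s ∂μ) * (c * c) +
      (-2 * ∫ s, ‖w s • F s‖ ∂μ) * c + ∫ s, w s * (‖F s‖ ^ 2 / ρ s) ∂μ := by
    have h : 0 ≤ ∫ s, (w s * ρ s * (c * c) + ‖w s • F s‖ * (-2 * c)
        + w s * (‖F s‖ ^ 2 / ρ s)) ∂μ := by
      refine integral_nonneg fun s => ?_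
      have hs : w s * ρ s * (c * c) + ‖w s • F s‖ * (-2 * c) + w s * (‖F s‖ ^ 2 / ρ s)
          = w s * ((c * ρ s - ‖F s‖) ^ 2 / ρ s) := by
        have := (hρ s).ne'
        rw [norm_smul, Real.norm_of_nonneg (hw s)]
        field_simp
        ring
      simp only [hs, Pi.zero_apply]
      exact mul_nonneg (hw s) (div_nonneg (sq_nonneg _) (hρ s).le)
    rw [integral_add ((hwρ.mul_const _).fun_add (hwF.norm.mul_const _)) hwA,
      integral_add (hwρ.mul_const _) (hwF.norm.mul_const _), integral_mul_const,
      integral_mul_const] at h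
    linarith
  have hdiscrim := discrim_le_zero quadratic_nonneg
  have hnorm := pow_le_pow_left₀ (norm_nonneg _)
    (norm_integral_le_integral_norm (μ := μ) fun s => w s • F s) 2
  rw [discrim] at hdiscrim
  linarith

/-- A strongly measurable momentum with finite action over an integrable density is integrable. -/
theorem integrable_of_integrable_norm_sq_div
    {α E : Type*} [MeasurableSpace α] {μ : Measure α} [NormedAddCommGroup E]
    {ρ : α → ℝ} {F : α → E} (hρ : ∀ s, 0 < ρ s) (hρ_int : Integrable ρ μ)
    (hF : AEStronglyMeasurable F μ) (hA : Integrable (fun s => ‖F s‖ ^ 2 / ρ s) μ) :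
    Integrable F μ := by
  refine (hρ_int.add hA).mono' hF (ae_of_all _ fun s => ?_)
  have h : ρ s + ‖F s‖ ^ 2 / ρ s - ‖F s‖ = ((ρ s - ‖F s‖) ^ 2 + ρ s * ‖F s‖) / ρ s := by
    have := (hρ s).ne'
    field_simp
    ring
  have h_nonneg : 0 ≤ ((ρ s - ‖F s‖) ^ 2 + ρ s * ‖F s‖) / ρ s := by
    have := hρ s
    positivity
  simp only [Pi.add_apply]
  linarith

/-- Time-mollification does not increase the kinetic action: for a probability
mollifier `η`, a positive integrable density `ρ` and a momentum `F` with finite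
action `∫ ‖F‖²/ρ < ∞`, the convolutions `η∗F` and `η∗ρ` are well defined a.e.,
`η∗F` vanishes a.e. where `η∗ρ` does, and
`∫ ‖η∗F‖²/(η∗ρ) ≤ ∫ ‖F‖²/ρ` (the left integrand being `0` where `η∗ρ = 0`,
which is the convention of real division by zero). -/
theorem mollification_kinetic_action
    {E : Type*} [NormedAddCommGroup E] [InnerProductSpace ℝ E] [CompleteSpace E]
    (η : ℝ → ℝ) (hη_nonneg : ∀ t, 0 ≤ η t) (hη_int : Integrable η)
    (hη_mass : ∫ t, η t = 1)
    (ρ : ℝ → ℝ) (hρ_pos : ∀ t, 0 < ρ t) (hρ_int : Integrable ρ)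
    (F : ℝ → E) (hF_meas : StronglyMeasurable F)
    (hAction : Integrable (fun t => ‖F t‖ ^ 2 / ρ t)) :
    Integrable F ∧
    (∀ᵐ t : ℝ, Integrable (fun s => η (t - s) • F s)) ∧
    (∀ᵐ t : ℝ, Integrable (fun s => η (t - s) * ρ s)) ∧
    (∀ᵐ t : ℝ, (∫ s, η (t - s) * ρ s) = 0 → (∫ s, η (t - s) • F s) = 0) ∧
    ∫⁻ t, ENNReal.ofReal (‖∫ s, η (t - s) • F s‖ ^ 2 / ∫ s, η (t - s) * ρ s) ≤
      ∫⁻ t, ENNReal.ofReal (‖F t‖ ^ 2 / ρ t) := by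
  have hF_int := integrable_of_integrable_norm_sq_div hρ_pos hρ_int
    hF_meas.aestronglyMeasurable hAction
  have hηF : ∀ᵐ t : ℝ, Integrable (fun s => η (t - s) • F s) :=
    hF_int.ae_convolution_exists (ContinuousLinearMap.lsmul ℝ ℝ).flip hη_int
  have hηmul {g : ℝ → ℝ} (hg : Integrable g) :
      ∀ᵐ t : ℝ, Integrable (fun s => η (t - s) * g s) :=
    hg.ae_convolution_exists (ν := volume) (ContinuousLinearMap.lsmul ℝ ℝ).flip hη_int
  have hηρ := hηmul hρ_int
  have hηA := hηmul hAction
  have hCS : ∀ᵐ t : ℝ, ‖∫ s, η (t - s) • F s‖ ^ 2 ≤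
      (∫ s, η (t - s) * ρ s) * ∫ s, η (t - s) * (‖F s‖ ^ 2 / ρ s) := by
    filter_upwards [hηF, hηρ, hηA] with t hF hρ hA
    exact norm_integral_smul_sq_le_integral_mul_integral (fun s => hη_nonneg (t - s)) hρ_pos
      hF hρ hA
  have hA_nonneg (s : ℝ) : 0 ≤ ‖F s‖ ^ 2 / ρ s := div_nonneg (sq_nonneg _) (hρ_pos s).le
  have hηA_nonneg (t : ℝ) : 0 ≤ ∫ s, η (t - s) * (‖F s‖ ^ 2 / ρ s) :=
    integral_nonneg fun s => mul_nonneg (hη_nonneg _) (hA_nonneg s)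
  refine ⟨hF_int, hηF, hηρ, ?_, ?_⟩
  · filter_upwards [hCS] with t ht h0
    rw [h0, zero_mul] at ht
    exact norm_eq_zero.mp (pow_eq_zero_iff two_ne_zero |>.mp (le_antisymm ht (sq_nonneg _)))
  · have hconv_int : Integrable fun t => ∫ s, η (t - s) * (‖F s‖ ^ 2 / ρ s) :=
      hAction.integrable_convolution (ContinuousLinearMap.lsmul ℝ ℝ).flip hη_int
    have hconv : ∫ t, ∫ s, η (t - s) * (‖F s‖ ^ 2 / ρ s) = ∫ t, ‖F t‖ ^ 2 / ρ t := by
      have h := integral_convolution (ContinuousLinearMap.lsmul ℝ ℝ).flip hAction hη_int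
      simpa [convolution, hη_mass] using h
    calc
      _ ≤ ∫⁻ t, ENNReal.ofReal (∫ s, η (t - s) * (‖F s‖ ^ 2 / ρ s)) := by
        refine lintegral_mono_ae ?_
        filter_upwards [hCS] with t ht
        refine ENNReal.ofReal_le_ofReal (div_le_of_le_mul₀ ?_ (hηA_nonneg t) ?_)
        · exact integral_nonneg fun s => mul_nonneg (hη_nonneg _) (hρ_pos s).le
        · rwa [mul_comm]
      _ = ENNReal.ofReal (∫ t, ∫ s, η (t - s) * (‖F s‖ ^ 2 / ρ s)) :=
        (ofReal_integral_eq_lintegral_ofReal hconv_int (ae_of_all _ hηA_nonneg)).symm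
      _ = _ := by
        rw [hconv, ofReal_integral_eq_lintegral_ofReal hAction (ae_of_all _ hA_nonneg)]
end
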